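/- Let L_{K3,2} = 3U ⊕ 2E_8(−1) ⊕ ⟨−2⟩ and let h ∈ L_{K3,2} be a primitive vector with h² = 2d > 0 and div(h) = 2. Then d ≡ 3 (mod 4), and the orthogonal complement of h in L_{K3,2} is isometric to 2U ⊕ 2E_8(−1) ⊕ Q, where Q is the rank-2 even lattice with Gram matrix [[−2, 1], [1, −(d+1)/2]], whose determinant is d and whose discriminant group is cyclic of order d. -/

import Mathlib

open Matrix

/-- The subgroup of vectors of `ℚ^ι` with integral coordinates. -/
def intVecs (ι : Type*) [Fintype ι] : AddSubgroup (ι → ℚ) where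
  carrier := {x | ∀ i, ∃ z : ℤ, x i = z}
  add_mem' := by
    intro a b ha hb i
    obtain ⟨z, hz⟩ := ha i
    obtain ⟨w, hw⟩ := hb i
    exact ⟨z + w, by simp [Pi.add_apply, hz, hw]⟩
  zero_mem' := fun i => ⟨0, by simp⟩
  neg_mem' := by
    intro a ha i
    obtain ⟨z, hz⟩ := ha i
    exact ⟨-z, by simp [Pi.neg_apply, hz]⟩

/-- The dual lattice `L∨ ⊆ L ⊗ ℚ` of the lattice with Gram matrix `B`. -/
def dualLat {ι : Type*} [Fintype ι] (B : Matrix ι ι ℤ) : AddSubgroup (ι → ℚ) where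
  carrier := {x | ∀ v : ι → ℤ, ∃ z : ℤ,
    x ⬝ᵥ (B.map (Int.cast : ℤ → ℚ)).mulVec (fun i => (v i : ℚ)) = z}
  add_mem' := by
    intro a b ha hb v
    obtain ⟨z, hz⟩ := ha v
    obtain ⟨w, hw⟩ := hb v
    exact ⟨z + w, by rw [add_dotProduct, hz, hw]; push_cast; ring⟩
  zero_mem' := fun v => ⟨0, by simp⟩
  neg_mem' := by
    intro a ha v
    obtain ⟨z, hz⟩ := ha v
    exact ⟨-z, by rw [neg_dotProduct, hz]; push_cast; ring⟩

/-- The discriminant group `D(L) = L∨/L` of the lattice with Gram matrix `B`. -/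
abbrev discGroup {ι : Type*} [Fintype ι] (B : Matrix ι ι ℤ) :=
  (dualLat B) ⧸ ((intVecs ι).addSubgroupOf (dualLat B))

/-- Gram matrix of the hyperbolic plane `U`. -/
def hypU : Matrix (Fin 2) (Fin 2) ℤ := !![0, 1; 1, 0]

/-- Gram matrix of the positive definite `E₈` lattice (the E₈ Cartan matrix). -/
def E8mat : Matrix (Fin 8) (Fin 8) ℤ :=
  !![2, 0, -1, 0, 0, 0, 0, 0;
     0, 2, 0, -1, 0, 0, 0, 0;
     -1, 0, 2, -1, 0, 0, 0, 0;
     0, -1, -1, 2, -1, 0, 0, 0;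
     0, 0, 0, -1, 2, -1, 0, 0;
     0, 0, 0, 0, -1, 2, -1, 0;
     0, 0, 0, 0, 0, -1, 2, -1;
     0, 0, 0, 0, 0, 0, -1, 2]

/-- Index type of `L_{K3,2} = 3U ⊕ 2E₈(−1) ⊕ ⟨−2⟩`. -/
abbrev K32Ix : Type := (Fin 2 ⊕ (Fin 2 ⊕ (Fin 2 ⊕ (Fin 8 ⊕ Fin 8)))) ⊕ Fin 1

/-- Gram matrix of the Beauville lattice `L_{K3,2} = 3U ⊕ 2E₈(−1) ⊕ ⟨−2⟩`
of deformation K3^[2] manifolds. -/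
def K32mat : Matrix K32Ix K32Ix ℤ :=
  Matrix.fromBlocks
    (Matrix.fromBlocks hypU 0 0
      (Matrix.fromBlocks hypU 0 0
        (Matrix.fromBlocks hypU 0 0
          (Matrix.fromBlocks (-E8mat) 0 0 (-E8mat))))) 0 0
    (Matrix.of fun _ _ => (-2 : ℤ))

/-- The rank-2 even lattice `Q(d)` with Gram matrix `[[−2,1],[1,−(d+1)/2]]`. -/
def Qmat (d : ℤ) : Matrix (Fin 2) (Fin 2) ℤ := !![-2, 1; 1, -((d + 1) / 2)]

/-- Index type of `2U ⊕ 2E₈(−1) ⊕ Q`. -/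
abbrev LQIx : Type := Fin 2 ⊕ (Fin 2 ⊕ (Fin 8 ⊕ (Fin 8 ⊕ Fin 2)))

/-- Gram matrix of `2U ⊕ 2E₈(−1) ⊕ Q(d)`. -/
def LQmat (d : ℤ) : Matrix LQIx LQIx ℤ :=
  Matrix.fromBlocks hypU 0 0
    (Matrix.fromBlocks hypU 0 0
      (Matrix.fromBlocks (-E8mat) 0 0
        (Matrix.fromBlocks (-E8mat) 0 0 (Qmat d))))


section Abstract
variable {ι : Type*} (B : LinearMap.BilinForm ℤ (ι → ℤ))

/-- `g` preserves the form `B`. -/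
def IsIso (g : (ι → ℤ) ≃ₗ[ℤ] (ι → ℤ)) : Prop := ∀ v w, B (g v) (g w) = B v w

/-- `s` and `t` are in the same orbit. -/
def Orb (s t : (ι → ℤ)) : Prop := ∃ g : (ι → ℤ) ≃ₗ[ℤ] (ι → ℤ), IsIso B g ∧ g s = t

variable {B}

theorem Orb.trans {s t u : (ι → ℤ)} (h1 : Orb B s t) (h2 : Orb B t u) : Orb B s u := by
  obtain ⟨g, hg, rfl⟩ := h1
  obtain ⟨k, hk, rfl⟩ := h2
  exact ⟨g.trans k, fun v w => by simp [-zsmul_eq_mul, hk _ _, hg _ _], by simp [-zsmul_eq_mul]⟩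

/-- Eichler transvection as a linear map. -/
def eich (B : LinearMap.BilinForm ℤ (ι → ℤ)) (e a : (ι → ℤ)) (q : ℤ) : (ι → ℤ) →ₗ[ℤ] (ι → ℤ) :=
  LinearMap.id - (B a).smulRight e + (B e).smulRight a - q • (B e).smulRight e

theorem eich_apply (e a : (ι → ℤ)) (q : ℤ) (v : (ι → ℤ)) :
    eich B e a q v = v - B a v • e + B e v • a - q • B e v • e := by
  simp [-zsmul_eq_mul, eich]

theorem eich_inv (hs : ∀ v w, B v w = B w v) {e a : (ι → ℤ)} {q : ℤ} (hee : B e e = 0) (hea : B e a = 0)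
    (haa : B a a = 2 * q) (v : (ι → ℤ)) : eich B e (-a) q (eich B e a q v) = v := by
  have hae : B a e = 0 := by rw [hs]; exact hea
  simp only [eich_apply, map_add, map_sub, map_neg, map_smul, hee, hea, hae, haa,
    LinearMap.neg_apply, smul_eq_mul]
  module

theorem eich_iso (hs : ∀ v w, B v w = B w v) {e a : (ι → ℤ)} {q : ℤ} (hee : B e e = 0) (hea : B e a = 0)
    (haa : B a a = 2 * q) (v w : (ι → ℤ)) : B (eich B e a q v) (eich B e a q w) = B v w := by
  have hae : B a e = 0 := by rw [hs]; exact hea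
  simp only [eich_apply, map_add, map_sub, map_smul, hee, hea, hae, haa,
    LinearMap.add_apply, LinearMap.sub_apply, LinearMap.smul_apply, smul_eq_mul,
    hs v e, hs v a]
  ring

theorem orb_eich (hs : ∀ v w, B v w = B w v) {e a : (ι → ℤ)} (q : ℤ) (hee : B e e = 0) (hea : B e a = 0)
    (haa : B a a = 2 * q) (v : (ι → ℤ)) : Orb B v (v - B a v • e + B e v • a - q • B e v • e) := by
  refine ⟨LinearEquiv.ofLinearMap (eich B e a q) (eich B e (-a) q) ?_ ?_, ?_, ?_⟩
  · refine LinearMap.ext fun v => ?_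
    have := eich_inv (B := B) hs (a := -a) hee (by simpa [-zsmul_eq_mul] using hea) (by simpa [-zsmul_eq_mul] using haa) v
    simpa [-zsmul_eq_mul] using this
  · refine LinearMap.ext fun v => ?_
    exact eich_inv hs hee hea haa v
  · intro v w
    exact eich_iso hs hee hea haa v w
  · exact eich_apply e a q v

theorem orb_symm_pair {s t : (ι → ℤ)} (h1 : Orb B s t) : Orb B t s := by
  obtain ⟨g, hg, rfl⟩ := h1
  exact ⟨g.symm, fun v w => by rw [← hg]; simp, by simp [-zsmul_eq_mul]⟩

theorem orb_move1 (hs : ∀ v w, B v w = B w v) {e₁ f₁ e₂ f₂ : (ι → ℤ)}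
    (h11 : B e₁ e₁ = 0) (g11 : B f₁ f₁ = 0) (k11 : B e₁ f₁ = 1)
    (h22 : B e₂ e₂ = 0) (g22 : B f₂ f₂ = 0) (k22 : B e₂ f₂ = 1)
    (x1 : B e₁ e₂ = 0) (x2 : B e₁ f₂ = 0) (x3 : B f₁ e₂ = 0) (x4 : B f₁ f₂ = 0) (t : ℤ) :
    Orb B e₁ (e₂ + t • e₁) := by
  have y1 := hs e₂ e₁; have y2 := hs f₂ e₁; have y3 := hs e₂ f₁; have y4 := hs f₂ f₁
  have y5 := hs f₁ e₁; have y6 := hs f₂ e₂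
  rw [x1] at y1; rw [x2] at y2; rw [x3] at y3; rw [x4] at y4; rw [k11] at y5; rw [k22] at y6
  have A := orb_eich (B := B) hs (e := e₂) (a := -f₁) 0 h22 (by simp [-zsmul_eq_mul, y3]) (by simp [-zsmul_eq_mul, g11]) e₁
  have C := orb_eich (B := B) hs (e := e₁) (a := (1 - t) • f₂) 0 h11 (by simp [-zsmul_eq_mul, x2]) (by simp [-zsmul_eq_mul, g22])
    (e₁ + e₂)
  have A' : Orb B e₁ (e₁ + e₂) := by
    convert A using 1
    simp only [map_neg, LinearMap.neg_apply, y5, y1]; module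
  refine A'.trans ?_
  convert C using 1
  simp only [map_smul, LinearMap.smul_apply, map_add, y2, y6, h11, x1, smul_eq_mul]; module

theorem dvd_all (hs : ∀ v w, B v w = B w v) (hev : ∀ v, ∃ q, B v v = 2 * q) {e₁ f₁ e₂ f₂ : (ι → ℤ)}
    (h11 : B e₁ e₁ = 0) (g11 : B f₁ f₁ = 0) (k11 : B e₁ f₁ = 1)
    (h22 : B e₂ e₂ = 0) (g22 : B f₂ f₂ = 0) (k22 : B e₂ f₂ = 1)
    (x1 : B e₁ e₂ = 0) (x2 : B e₁ f₂ = 0) (x3 : B f₁ e₂ = 0) (x4 : B f₁ f₂ = 0) (h : (ι → ℤ))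
    (hmin : ∀ x : ℤ, (∀ t : ℤ, ∃ s, Orb B e₁ s ∧ B s h = x + t * B e₁ h) → B e₁ h ∣ x) (v : (ι → ℤ)) :
    B e₁ h ∣ B v h := by
  have y1 := hs e₂ e₁; have y2 := hs f₂ e₁; have y3 := hs e₂ f₁; have y4 := hs f₂ f₁
  have y5 := hs f₁ e₁; have y6 := hs f₂ e₂
  rw [x1] at y1; rw [x2] at y2; rw [x3] at y3; rw [x4] at y4; rw [k11] at y5; rw [k22] at y6
  have E2 : ∀ t : ℤ, Orb B e₁ (e₂ + t • e₁) := fun t =>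
    orb_move1 hs h11 g11 k11 h22 g22 k22 x1 x2 x3 x4 t
  have F2 : ∀ t : ℤ, Orb B e₁ (f₂ + t • e₁) := fun t =>
    orb_move1 hs h11 g11 k11 g22 h22 y6 x2 x1 x4 x3 t
  have de2 : B e₁ h ∣ B e₂ h := hmin _ fun t => ⟨_, E2 t, by simp [-zsmul_eq_mul]⟩
  have df2 : B e₁ h ∣ B f₂ h := hmin _ fun t => ⟨_, F2 t, by simp [-zsmul_eq_mul]⟩
  have df1 : B e₁ h ∣ B f₁ h := by
    obtain ⟨j, hj⟩ := df2
    have : B e₁ h ∣ (1 + j) * B e₂ h + B f₁ h := by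
      refine hmin _ fun t => ?_
      have A := orb_eich (B := B) hs (e := f₂) (a := f₁ + t • e₁) t g22 (by simp [-zsmul_eq_mul, y4, y2])
        (by simp [-zsmul_eq_mul, g11, h11, k11, y5]; ring) (e₂ + (0 : ℤ) • e₁)
      have C := orb_eich (B := B) hs (e := e₁) (a := j • e₂) 0 h11 (by simp [-zsmul_eq_mul, x1])
        (by simp [-zsmul_eq_mul, h22]) (e₂ + f₁ + t • e₁ - t • f₂)
      refine ⟨_, ((E2 0).trans A).trans (?_ : Orb B _ (e₂ + f₁ + t • e₁ - t • f₂)) |>.trans C, ?_⟩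
      · refine ⟨LinearEquiv.refl ℤ (ι → ℤ), fun _ _ => rfl, ?_⟩
        simp [-zsmul_eq_mul, x3, x1, y6]
        module
      · simp [-zsmul_eq_mul, h22, k22, y3, y1, x1, x2, k11, h11, hj]
        ring
    exact (dvd_add_right (de2.mul_left _)).1 this
  have dN : ∀ y, B e₁ y = 0 → B f₁ y = 0 → B e₂ y = 0 → B f₂ y = 0 → B e₁ h ∣ B y h := by
    intro y z1 z2 z3 z4
    obtain ⟨q, hq⟩ := hev y
    have : B e₁ h ∣ B e₂ h + B y h - q * B f₂ h := by
      refine hmin _ fun t => ?_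
      have A := orb_eich (B := B) hs (e := f₂) (a := y) q g22 z4 hq (e₂ + t • e₁)
      refine ⟨_, (E2 t).trans A, ?_⟩
      simp [-zsmul_eq_mul, y6, y2, hs y, z3, z1]
      ring
    have h2 := (dvd_add_right de2).1 (by simpa [add_sub_assoc] using this)
    have := dvd_add h2 (df2.mul_left q)
    simpa [-zsmul_eq_mul] using this
  have key := dN (v - B f₁ v • e₁ - B e₁ v • f₁ - B f₂ v • e₂ - B e₂ v • f₂)
    (by simp [-zsmul_eq_mul, h11, k11, x1, x2]) (by simp [-zsmul_eq_mul, y5, g11, x3, x4]) (by simp [-zsmul_eq_mul, h22, y1, y3, k22])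
    (by simp [-zsmul_eq_mul, y2, y4, y6, g22])
  have := dvd_add (dvd_add (dvd_add (dvd_add key (dvd_mul_left (B e₁ h) (B f₁ v)))
    (df1.mul_left (B e₁ v))) (de2.mul_left (B f₂ v))) (df2.mul_left (B e₂ v))
  simp only [map_sub, map_smul, LinearMap.sub_apply, LinearMap.smul_apply, smul_eq_mul] at this
  ring_nf at this
  exact this

theorem exists_min (e₁ h : (ι → ℤ)) : ∃ g : (ι → ℤ) ≃ₗ[ℤ] (ι → ℤ), IsIso B g ∧
    ∀ x : ℤ, (∀ t : ℤ, ∃ s, Orb B e₁ s ∧ B s h = x + t * B (g e₁) h) → B (g e₁) h ∣ x := by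
  classical
  by_cases hall : ∀ s, Orb B e₁ s → B s h = 0
  · have h0 : B e₁ h = 0 := hall e₁ ⟨LinearEquiv.refl ℤ (ι → ℤ), fun _ _ => rfl, rfl⟩
    refine ⟨LinearEquiv.refl ℤ (ι → ℤ), fun _ _ => rfl, fun x hx => ?_⟩
    obtain ⟨s, hs, hx⟩ := hx 0
    rw [hall s hs] at hx
    simp at hx
    rw [← hx]; exact dvd_zero _
  · push Not at hall
    have hex : ∃ n : ℕ, n ≠ 0 ∧ ∃ s, Orb B e₁ s ∧ (B s h).natAbs = n := by
      obtain ⟨s, hs, hne⟩ := hall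
      exact ⟨_, by simpa [-zsmul_eq_mul] using hne, s, hs, rfl⟩
    obtain ⟨hn0, s, ⟨g, hg, rfl⟩, hn⟩ := Nat.find_spec hex
    refine ⟨g, hg, fun x hx => ?_⟩
    have hm0 : B (g e₁) h ≠ 0 := by
      intro h0; rw [h0] at hn; exact hn0 hn.symm
    obtain ⟨s, hs, hx⟩ := hx (-(x / B (g e₁) h))
    have hr : B s h = x % B (g e₁) h := by
      rw [hx]; have := Int.emod_add_mul_ediv x (B (g e₁) h); linarith
    by_contra hnd
    have hne : B s h ≠ 0 := by
      rw [hr]; exact fun h' => hnd (Int.dvd_of_emod_eq_zero h')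
    have := Nat.find_min' hex ⟨by simpa [-zsmul_eq_mul] using hne, s, hs, rfl⟩
    rw [← hn] at this
    have h1 := Int.emod_nonneg x hm0
    have h2 := Int.emod_lt_abs x hm0
    rw [hr] at this
    rw [Int.abs_eq_natAbs] at h2
    omega

theorem exists_two (hs : ∀ v w, B v w = B w v) (hev : ∀ v, ∃ q, B v v = 2 * q) {e₁ f₁ e₂ f₂ : (ι → ℤ)}
    (h11 : B e₁ e₁ = 0) (g11 : B f₁ f₁ = 0) (k11 : B e₁ f₁ = 1)
    (h22 : B e₂ e₂ = 0) (g22 : B f₂ f₂ = 0) (k22 : B e₂ f₂ = 1)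
    (x1 : B e₁ e₂ = 0) (x2 : B e₁ f₂ = 0) (x3 : B f₁ e₂ = 0) (x4 : B f₁ f₂ = 0) (h : (ι → ℤ))
    (hdiv : ∀ v, 2 ∣ B v h) (hdiv' : ∃ v, B v h = 2) :
    ∃ h', Orb B h h' ∧ B e₁ h' = 2 := by
  obtain ⟨g, hg, hmin⟩ := exists_min (B := B) e₁ h
  have := dvd_all (B := B) hs hev (e₁ := g e₁) (f₁ := g f₁) (e₂ := g e₂) (f₂ := g f₂)
    (by rwa [hg]) (by rwa [hg]) (by rwa [hg]) (by rwa [hg]) (by rwa [hg]) (by rwa [hg])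
    (by rwa [hg]) (by rwa [hg]) (by rwa [hg]) (by rwa [hg]) h (by
      intro x hx
      refine hmin x fun t => ?_
      obtain ⟨s, h1, h2⟩ := hx t
      exact ⟨s, Orb.trans ⟨g, hg, rfl⟩ h1, h2⟩)
  obtain ⟨v, hv⟩ := hdiv'
  have h2 := this v
  rw [hv] at h2
  have h3 := hdiv (g e₁)
  have hval : B e₁ (g.symm h) = B (g e₁) h := by rw [← hg]; simp
  have hO : Orb B h (g.symm h) := orb_symm_pair ⟨g, hg, by simp [-zsmul_eq_mul]⟩
  rcases (Int.natAbs_eq_natAbs_iff.1 (Nat.dvd_antisymm (Int.natAbs_dvd_natAbs.2 h2)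
    (Int.natAbs_dvd_natAbs.2 h3))) with h4 | h4
  · exact ⟨g.symm h, hO, by rw [hval, h4]⟩
  · refine ⟨-g.symm h, hO.trans ⟨LinearEquiv.neg ℤ, fun v w => by simp, by simp [-zsmul_eq_mul]⟩, ?_⟩
    rw [map_neg, hval, h4]; rfl

end Abstract

section Concrete

theorem Qmat_det (d : ℤ) (h3 : d % 4 = 3) : (Qmat d).det = d := by
  simp only [Qmat, det_fin_two_of]
  omega

theorem Q_disc (d : ℤ) (hd : 0 < d) (h3 : d % 4 = 3) :
    Nonempty (discGroup (Qmat d) ≃+ ZMod d.toNat) := by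
  obtain ⟨n, hn⟩ : ∃ n, d = 4 * n - 1 := ⟨(d + 1) / 4, by omega⟩
  have hq : (d + 1) / 2 = 2 * n := by omega
  have hd0 : (d : ℚ) ≠ 0 := by exact_mod_cast hd.ne'
  have hdn : (d : ℚ) = 4 * n - 1 := by rw [hn]; push_cast; ring
  have hmem : ∀ x : Fin 2 → ℚ, x ∈ dualLat (Qmat d) ↔
      (∃ z : ℤ, -2 * x 0 + x 1 = z) ∧ ∃ z : ℤ, x 0 - 2 * n * x 1 = z := by
    intro x
    have hform : ∀ v : Fin 2 → ℤ, x ⬝ᵥ ((Qmat d).map (Int.cast : ℤ → ℚ)).mulVec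
        (fun i => (v i : ℚ)) = (-2 * x 0 + x 1) * v 0 + (x 0 - 2 * n * x 1) * v 1 := by
      intro v
      simp [Qmat, hq, dotProduct, mulVec, Fin.sum_univ_two]
      ring
    constructor
    · intro hx
      constructor
      · obtain ⟨z, hz⟩ := hx ![1, 0]
        exact ⟨z, by rw [← hz, hform]; simp⟩
      · obtain ⟨z, hz⟩ := hx ![0, 1]
        exact ⟨z, by rw [← hz, hform]; simp⟩
    · rintro ⟨⟨z, hz⟩, ⟨w, hw⟩⟩ v
      exact ⟨z * v 0 + w * v 1, by rw [hform, hz, hw]; push_cast; ring⟩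
  have hint : ∀ x : dualLat (Qmat d), ∃ z : ℤ, (d : ℚ) * x.1 1 = z := by
    intro x
    obtain ⟨⟨z, hz⟩, ⟨w, hw⟩⟩ := (hmem _).1 x.2
    exact ⟨-(z + 2 * w), by push_cast; rw [← hz, ← hw, hdn]; ring⟩
  choose F hF using hint
  have hdz : ((d.toNat : ℕ) : ℤ) = d := Int.toNat_of_nonneg hd.le
  let f : dualLat (Qmat d) →+ ZMod d.toNat := AddMonoidHom.mk' (fun x => (F x : ZMod d.toNat)) (by
    intro x y
    have : F (x + y) = F x + F y := by
      have h1 := hF (x + y)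
      simp only [AddSubgroup.coe_add, Pi.add_apply, mul_add, hF] at h1
      exact_mod_cast h1.symm
    rw [this]; push_cast; rfl)
  have hf : ∀ x, f x = (F x : ZMod d.toNat) := fun x => rfl
  have hsurj : Function.Surjective f := by
    intro k
    obtain ⟨k, rfl⟩ := ZMod.intCast_surjective k
    refine ⟨⟨![2 * n * k / d, k / d], (hmem _).2 ⟨⟨-k, ?_⟩, ⟨0, ?_⟩⟩⟩, ?_⟩
    · simp
      field_simp
      rw [hdn]; ring
    · simp
      ring
    · rw [hf]
      congr 1
      have := hF ⟨![2 * n * k / d, k / d], (hmem _).2 ⟨⟨-k, by simp; field_simp; rw [hdn]; ring⟩,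
        ⟨0, by simp; ring⟩⟩⟩
      simp at this
      rw [mul_div_cancel₀ _ hd0] at this
      exact_mod_cast this.symm
  have hker : f.ker = (intVecs (Fin 2)).addSubgroupOf (dualLat (Qmat d)) := by
    ext x
    rw [AddMonoidHom.mem_ker, AddSubgroup.mem_addSubgroupOf, hf, ZMod.intCast_zmod_eq_zero_iff_dvd,
      hdz]
    constructor
    · rintro ⟨b, hb⟩
      have h1 : x.1 1 = b := by
        have := hF x
        rw [hb] at this
        push_cast at this
        exact mul_left_cancel₀ hd0 this
      obtain ⟨-, ⟨w, hw⟩⟩ := (hmem _).1 x.2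
      intro i
      fin_cases i
      · refine ⟨w + 2 * n * b, ?_⟩
        push_cast
        rw [← hw, ← h1]
        simp
      · exact ⟨b, h1⟩
    · intro hx
      obtain ⟨b, hb⟩ := hx 1
      refine ⟨b, ?_⟩
      have := hF x
      rw [hb] at this
      exact_mod_cast this.symm
  exact ⟨(QuotientAddGroup.quotientAddEquivOfEq hker.symm).trans
    (QuotientAddGroup.quotientKerEquivOfSurjective f hsurj)⟩

/-- Inverse of the E8 Cartan matrix. -/
def E8inv : Matrix (Fin 8) (Fin 8) ℤ :=
  !![4, 5, 7, 10, 8, 6, 4, 2;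
     5, 8, 10, 15, 12, 9, 6, 3;
     7, 10, 14, 20, 16, 12, 8, 4;
     10, 15, 20, 30, 24, 18, 12, 6;
     8, 12, 16, 24, 20, 15, 10, 5;
     6, 9, 12, 18, 15, 12, 8, 4;
     4, 6, 8, 12, 10, 8, 6, 3;
     2, 3, 4, 6, 5, 4, 3, 2]

theorem E8_mul_inv : E8mat * E8inv = 1 := by decide

theorem hypU_mul : hypU * hypU = 1 := by decide

theorem E8_symm : E8matᵀ = E8mat := by decide

theorem hypU_symm : hypUᵀ = hypU := by decide

/-- Partial inverse of the Gram matrix. -/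
def K32inv : Matrix K32Ix K32Ix ℤ :=
  Matrix.fromBlocks
    (Matrix.fromBlocks hypU 0 0
      (Matrix.fromBlocks hypU 0 0
        (Matrix.fromBlocks hypU 0 0
          (Matrix.fromBlocks (-E8inv) 0 0 (-E8inv))))) 0 0 0

theorem K32_mul_inv : K32mat * K32inv = Matrix.fromBlocks 1 0 0 0 := by
  simp [K32mat, K32inv, fromBlocks_multiply, hypU_mul, E8_mul_inv, fromBlocks_one]

theorem K32_symm : K32matᵀ = K32mat := by
  simp [K32mat, fromBlocks_transpose, hypU_symm, E8_symm]
  rfl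

/-- Half of the `E8` form. -/
def E8half : Matrix (Fin 8) (Fin 8) ℤ :=
  Matrix.of fun i j => if i < j then E8mat i j else if i = j then 1 else 0

/-- Half of the form `U`. -/
def Uhalf : Matrix (Fin 2) (Fin 2) ℤ := !![0, 1; 0, 0]

theorem E8half_add : E8half + E8halfᵀ = E8mat := by decide

theorem Uhalf_add : Uhalf + Uhalfᵀ = hypU := by decide

/-- Half of the form `K32mat`. -/
def K32half : Matrix K32Ix K32Ix ℤ :=
  Matrix.fromBlocks
    (Matrix.fromBlocks Uhalf 0 0
      (Matrix.fromBlocks Uhalf 0 0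
        (Matrix.fromBlocks Uhalf 0 0
          (Matrix.fromBlocks (-E8half) 0 0 (-E8half))))) 0 0
    (Matrix.of fun _ _ => (-1 : ℤ))

theorem K32half_add : K32half + K32halfᵀ = K32mat := by
  have h1 : -E8half + -E8halfᵀ = -E8mat := by rw [← E8half_add]; abel
  simp only [K32half, K32mat, fromBlocks_transpose, fromBlocks_add, transpose_zero, transpose_neg,
    Uhalf_add, h1, add_zero]
  congr 1

theorem K32_even (v : K32Ix → ℤ) : ∃ q, v ⬝ᵥ K32mat.mulVec v = 2 * q := by
  refine ⟨v ⬝ᵥ K32half.mulVec v, ?_⟩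
  have : v ⬝ᵥ K32halfᵀ.mulVec v = v ⬝ᵥ K32half.mulVec v := by
    rw [mulVec_transpose, dotProduct_comm, ← dotProduct_mulVec]
  rw [← K32half_add, add_mulVec, dotProduct_add, this]
  ring

theorem K32_comm (v w : K32Ix → ℤ) : v ⬝ᵥ K32mat.mulVec w = w ⬝ᵥ K32mat.mulVec v := by
  conv_lhs => rw [← K32_symm]
  rw [mulVec_transpose, dotProduct_comm, ← dotProduct_mulVec]

/-- The bilinear form of the Beauville lattice. -/
noncomputable def BK : LinearMap.BilinForm ℤ (K32Ix → ℤ) := Matrix.toBilin' K32mat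

theorem BK_apply (v w : K32Ix → ℤ) : BK v w = v ⬝ᵥ K32mat.mulVec w :=
  Matrix.toBilin'_apply' _ _ _

/-- Basis vector. -/
def bv (i : K32Ix) : K32Ix → ℤ := Pi.single i 1

theorem BK_bv (i j : K32Ix) : BK (bv i) (bv j) = K32mat i j := Matrix.toBilin'_single _ _ _

/-- Standard polarisation vector. -/
def hstd (n : ℤ) : K32Ix → ℤ := Sum.elim (Sum.elim ![2 * n, 2] 0) (fun _ => 1)

theorem BK_hstd (n : ℤ) (v : K32Ix → ℤ) : BK (hstd n) v =
    2 * n * v (Sum.inl (Sum.inl 1)) + 2 * v (Sum.inl (Sum.inl 0)) - 2 * v (Sum.inr 0) := by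
  rw [BK_apply]
  simp [hstd, K32mat, fromBlocks_mulVec, hypU, dotProduct, mulVec, Fin.sum_univ_two,
    Fintype.sum_sum_type]
  ring

/-- Standard basis of the orthogonal complement. -/
def bstd (n : ℤ) : LQIx → (K32Ix → ℤ)
  | Sum.inl i => bv (Sum.inl (Sum.inr (Sum.inl i)))
  | Sum.inr (Sum.inl i) => bv (Sum.inl (Sum.inr (Sum.inr (Sum.inl i))))
  | Sum.inr (Sum.inr (Sum.inl i)) => bv (Sum.inl (Sum.inr (Sum.inr (Sum.inr (Sum.inl i)))))
  | Sum.inr (Sum.inr (Sum.inr (Sum.inl i))) =>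
      bv (Sum.inl (Sum.inr (Sum.inr (Sum.inr (Sum.inr i)))))
  | Sum.inr (Sum.inr (Sum.inr (Sum.inr i))) =>
      ![bv (Sum.inl (Sum.inl 0)) + bv (Sum.inr 0),
        bv (Sum.inl (Sum.inl 1)) - n • bv (Sum.inl (Sum.inl 0))] i

theorem bstd_orth (n : ℤ) (i : LQIx) : BK (hstd n) (bstd n i) = 0 := by
  rw [BK_hstd]
  rcases i with i | i | i | i | i
  · simp [bstd, bv]
  · simp [bstd, bv]
  · simp [bstd, bv]
  · simp [bstd, bv]
  · fin_cases i <;> simp [bstd, bv, Pi.single_apply] <;> ring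

theorem bstd_gram (n d : ℤ) (hd : d = 4 * n - 1) (i j : LQIx) :
    BK (bstd n i) (bstd n j) = LQmat d i j := by
  have hq : (d + 1) / 2 = 2 * n := by omega
  have q1 (i : Fin 2) : i = 0 ∨ i = 1 := by fin_cases i <;> simp
  rcases i with i | i | i | i | i <;> rcases j with j | j | j | j | j <;>
    first
    | (simp [bstd, BK_bv, K32mat, LQmat]; done)
    | (rcases q1 i with rfl | rfl <;> rcases q1 j with rfl | rfl <;>
        simp [-zsmul_eq_mul, bstd, BK_bv, K32mat, LQmat, Qmat, hq, hypU] <;> ring; done)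
    | (rcases q1 j with rfl | rfl <;> simp [-zsmul_eq_mul, bstd, BK_bv, K32mat, LQmat]; done)
    | (rcases q1 i with rfl | rfl <;> simp [-zsmul_eq_mul, bstd, BK_bv, K32mat, LQmat]; done)

theorem bstd_sum (n : ℤ) (c : LQIx → ℤ) : ∑ i, c i • bstd n i =
    Sum.elim (Sum.elim
      ![c (Sum.inr (Sum.inr (Sum.inr (Sum.inr 0)))) -
          n * c (Sum.inr (Sum.inr (Sum.inr (Sum.inr 1)))),
        c (Sum.inr (Sum.inr (Sum.inr (Sum.inr 1))))]
      (Sum.elim (fun i => c (Sum.inl i)) (Sum.elim (fun i => c (Sum.inr (Sum.inl i)))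
        (Sum.elim (fun i => c (Sum.inr (Sum.inr (Sum.inl i))))
          (fun i => c (Sum.inr (Sum.inr (Sum.inr (Sum.inl i)))))))))
      (fun _ => c (Sum.inr (Sum.inr (Sum.inr (Sum.inr 0))))) := by
  have q1 (i : Fin 2) : i = 0 ∨ i = 1 := by fin_cases i <;> simp
  funext k
  rcases k with (k | k | k | k | k) | k
  · rcases q1 k with rfl | rfl <;>
      simp [Fintype.sum_sum_type, bstd, bv, Pi.single_apply, Finset.sum_apply]
    ring
  all_goals simp [Fintype.sum_sum_type, bstd, bv, Pi.single_apply, Finset.sum_apply]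
  exact fun h => absurd (Subsingleton.elim _ _) h

theorem bstd_indep (n : ℤ) : LinearIndependent ℤ (bstd n) := by
  rw [Fintype.linearIndependent_iff]
  intro c hc
  rw [bstd_sum] at hc
  have q1 (i : Fin 2) : i = 0 ∨ i = 1 := by fin_cases i <;> simp
  intro i
  rcases i with i | i | i | i | i
  · exact congrFun hc (Sum.inl (Sum.inr (Sum.inl i)))
  · exact congrFun hc (Sum.inl (Sum.inr (Sum.inr (Sum.inl i))))
  · exact congrFun hc (Sum.inl (Sum.inr (Sum.inr (Sum.inr (Sum.inl i)))))
  · exact congrFun hc (Sum.inl (Sum.inr (Sum.inr (Sum.inr (Sum.inr i)))))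
  · rcases q1 i with rfl | rfl
    · exact congrFun hc (Sum.inr 0)
    · exact congrFun hc (Sum.inl (Sum.inl 1))

theorem bstd_span (n : ℤ) (v : K32Ix → ℤ) (hv : BK (hstd n) v = 0) :
    v ∈ Submodule.span ℤ (Set.range (bstd n)) := by
  rw [BK_hstd] at hv
  have q1 (i : Fin 2) : i = 0 ∨ i = 1 := by fin_cases i <;> simp
  rw [Submodule.mem_span_range_iff_exists_fun]
  refine ⟨Sum.elim (fun i => v (Sum.inl (Sum.inr (Sum.inl i))))
    (Sum.elim (fun i => v (Sum.inl (Sum.inr (Sum.inr (Sum.inl i)))))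
    (Sum.elim (fun i => v (Sum.inl (Sum.inr (Sum.inr (Sum.inr (Sum.inl i))))))
    (Sum.elim (fun i => v (Sum.inl (Sum.inr (Sum.inr (Sum.inr (Sum.inr i))))))
    ![v (Sum.inr 0), v (Sum.inl (Sum.inl 1))]))), ?_⟩
  rw [bstd_sum]
  funext k
  rcases k with (k | k | k | k | k) | k
  · rcases q1 k with rfl | rfl
    · simp
      linarith
    · simp
  · simp
  · simp
  · simp
  · simp
  · obtain rfl : k = 0 := Subsingleton.elim _ _
    simp

theorem coord_even (h : K32Ix → ℤ) (hdiv : ∀ v, 2 ∣ BK h v)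
    (i : Fin 2 ⊕ (Fin 2 ⊕ (Fin 2 ⊕ (Fin 8 ⊕ Fin 8)))) : 2 ∣ h (Sum.inl i) := by
  have h1 := hdiv (K32inv.mulVec (bv (Sum.inl i)))
  rw [BK_apply, mulVec_mulVec, K32_mul_inv] at h1
  have : h ⬝ᵥ (fromBlocks 1 0 0 0 : Matrix K32Ix K32Ix ℤ) *ᵥ bv (Sum.inl i) = h (Sum.inl i) := by
    rw [bv, mulVec_single_one]
    rw [dotProduct, Fintype.sum_sum_type, Finset.sum_eq_single i]
    · simp
    · intro b _ hb
      simp [Matrix.one_apply, hb]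
    · simp
  rwa [this] at h1

theorem reduce (h : K32Ix → ℤ)
    (hprim : ∀ (k : ℤ) (v : K32Ix → ℤ), h = k • v → IsUnit k)
    (hdiv : ∀ v, 2 ∣ BK h v) (hdiv' : ∃ v, BK h v = 2) : ∃ n, Orb BK h (hstd n) := by
  have hs : ∀ v w, BK v w = BK w v := fun v w => by rw [BK_apply, BK_apply, K32_comm]
  have hev : ∀ v, ∃ q, BK v v = 2 * q := fun v => by
    obtain ⟨q, hq⟩ := K32_even v
    exact ⟨q, by rw [BK_apply, hq]⟩
  have q1 (i : Fin 2) : i = 0 ∨ i = 1 := by fin_cases i <;> simp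
  have hE : ∀ v, BK (bv (Sum.inl (Sum.inl 0))) v = v (Sum.inl (Sum.inl 1)) := by
    intro v
    rw [BK_apply, bv, single_one_dotProduct]
    simp [K32mat, fromBlocks_mulVec, hypU, mulVec, dotProduct, Fin.sum_univ_two]
  obtain ⟨h', ho, h2⟩ := exists_two (B := BK) hs hev (e₁ := bv (Sum.inl (Sum.inl 0)))
    (f₁ := bv (Sum.inl (Sum.inl 1))) (e₂ := bv (Sum.inl (Sum.inr (Sum.inl 0))))
    (f₂ := bv (Sum.inl (Sum.inr (Sum.inl 1)))) (by simp [BK_bv, K32mat, hypU])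
    (by simp [BK_bv, K32mat, hypU]) (by simp [BK_bv, K32mat, hypU]) (by simp [BK_bv, K32mat, hypU])
    (by simp [BK_bv, K32mat, hypU]) (by simp [BK_bv, K32mat, hypU]) (by simp [BK_bv, K32mat, hypU])
    (by simp [BK_bv, K32mat, hypU]) (by simp [BK_bv, K32mat, hypU]) (by simp [BK_bv, K32mat, hypU])
    h (fun v => by rw [hs]; exact hdiv v) (by obtain ⟨v, hv⟩ := hdiv'; exact ⟨v, by rw [hs]; exact hv⟩)
  have hO : ∀ k, Orb BK h k → ∀ v, 2 ∣ BK k v := by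
    rintro k ⟨g, hg, rfl⟩ v
    have := hdiv (g.symm v)
    rw [← hg] at this
    simpa using this
  have hc := coord_even h' (hO h' ho)
  have hodd : h' (Sum.inr 0) % 2 = 1 := by
    by_contra hne
    have hall : ∀ i, 2 ∣ h' i := by
      rintro (i | i)
      · exact hc i
      · obtain rfl : i = 0 := Subsingleton.elim _ _
        omega
    choose u hu using hall
    obtain ⟨g, hg, hgh⟩ := ho
    have h3 : h = (2 : ℤ) • g.symm u := by
      rw [← map_smul]
      apply g.injective
      rw [hgh, LinearEquiv.apply_symm_apply]
      funext i
      simp [hu i]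
    have := hprim 2 _ h3
    rw [Int.isUnit_iff] at this
    omega
  obtain ⟨q, hq⟩ := hev (Sum.elim (Sum.elim 0 (fun j => -(h' (Sum.inl (Sum.inr j)) / 2)))
    (fun _ => -((h' (Sum.inr 0) - 1) / 2)))
  have ho2 := ho.trans (orb_eich (B := BK) hs (e := bv (Sum.inl (Sum.inl 0))) q
    (by simp [BK_bv, K32mat, hypU]) (by rw [hE]; simp) hq h')
  have heven := coord_even _ (hO _ ho2) (Sum.inl 0)
  set h'' := h' - _ + _ - _ with hh''
  obtain ⟨n, hn⟩ := heven
  refine ⟨n, ?_⟩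
  convert ho2 using 1
  have hfv := hE h'
  rw [h2] at hfv
  funext k
  rcases k with (k | k) | k
  · rcases q1 k with rfl | rfl
    · rw [hn]; simp [hstd]
    · rw [hh'']
      simp [hstd, bv, ← hfv]
  · have := hc (Sum.inr k)
    rw [hh'', h2]
    simp [-zsmul_eq_mul, hstd, bv]
    omega
  · obtain rfl : k = 0 := Subsingleton.elim _ _
    rw [hh'', h2]
    simp [-zsmul_eq_mul, hstd, bv]
    omega

end Concrete

/-- If `h` is a primitive vector of `L_{K3,2}` with `h² = 2d > 0` and
`div(h) = 2`, then `d ≡ 3 (mod 4)` and the orthogonal complement of `h` is isometric to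
`2U ⊕ 2E₈(−1) ⊕ Q` where `Q` has Gram matrix `[[−2,1],[1,−(d+1)/2]]`, determinant `d` and
cyclic discriminant group of order `d`. -/
theorem stmt_15 (d : ℤ) (hd : 0 < d) (h : K32Ix → ℤ)
    (hprim : ∀ (k : ℤ) (v : K32Ix → ℤ), h = k • v → IsUnit k)
    (hlen : h ⬝ᵥ K32mat.mulVec h = 2 * d)
    (hdiv : ∀ m : ℤ, (∃ v : K32Ix → ℤ, h ⬝ᵥ K32mat.mulVec v = m) ↔ 2 ∣ m) :
    d % 4 = 3 ∧
    (∃ b : LQIx → (K32Ix → ℤ),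
      (∀ i, h ⬝ᵥ K32mat.mulVec (b i) = 0) ∧
      LinearIndependent ℤ b ∧
      (∀ v : K32Ix → ℤ, h ⬝ᵥ K32mat.mulVec v = 0 → v ∈ Submodule.span ℤ (Set.range b)) ∧
      (∀ i j, b i ⬝ᵥ K32mat.mulVec (b j) = LQmat d i j)) ∧
    (Qmat d).det = d ∧
    Nonempty (discGroup (Qmat d) ≃+ ZMod d.toNat) := by
  have hdiv1 : ∀ v, 2 ∣ BK h v := fun v => (hdiv _).1 ⟨v, (BK_apply h v).symm⟩
  have hdiv2 : ∃ v, BK h v = 2 := by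
    obtain ⟨v, hv⟩ := (hdiv 2).2 dvd_rfl
    exact ⟨v, by rw [BK_apply, hv]⟩
  obtain ⟨n, g, hg, hgh⟩ := reduce h hprim hdiv1 hdiv2
  have hdn : d = 4 * n - 1 := by
    rw [← BK_apply, ← hg, hgh, BK_hstd] at hlen
    simp [hstd] at hlen
    omega
  have h3 : d % 4 = 3 := by omega
  have hsymm : ∀ v, BK h v = BK (hstd n) (g v) := fun v => by rw [← hg, hgh]
  refine ⟨h3, ⟨fun i => g.symm (bstd n i), ?_, ?_, ?_, ?_⟩, Qmat_det d h3, Q_disc d hd h3⟩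
  · intro i
    rw [← BK_apply, hsymm, LinearEquiv.apply_symm_apply]
    exact bstd_orth n i
  · exact (bstd_indep n).map' g.symm.toLinearMap g.symm.ker
  · intro v hv
    rw [← BK_apply, hsymm] at hv
    have h1 := Submodule.mem_map_of_mem (f := g.symm.toLinearMap) (bstd_span n _ hv)
    rw [Submodule.map_span, ← Set.range_comp] at h1
    simpa [Function.comp_def] using h1
  · intro i j
    rw [← BK_apply, ← hg, LinearEquiv.apply_symm_apply, LinearEquiv.apply_symm_apply]
    exact bstd_gram n d hdn i j
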